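/- Let p be a stochastic language, let 0 ≤ η < 1, let U, V be finite subsets of Σ*, and for a string w ∈ Σ* let Ẑ_{η,w} be the U×V matrix Ẑ_{η,w}[u,v] = ∑_{x,y∈Σ*} η^{|x|+|y|}·(1_{w=xuvy} − p(xuvy)). Then for every w ∈ Σ*: ‖Ẑ_{η,w}‖_∞ ≤ (1−η)^{-2} + S_{p̂_η}^{(1)}, ‖Ẑ_{η,w}‖₁ ≤ (1−η)^{-2} + S_{p̂_η}^{(1)}, and hence ‖Ẑ_{η,w}‖₂ ≤ (1−η)^{-2} + S_{p̂_η}^{(1)}. -/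

import Mathlib

open Matrix

/-- The spectral norm (largest singular value) of a real matrix. -/
noncomputable def specNorm {m n : Type*} [Fintype m] [Fintype n] [DecidableEq n]
    (M : Matrix m n ℝ) : ℝ :=
  ‖(Matrix.toEuclideanLin M).toContinuousLinearMap‖

/-- The maximum absolute row sum norm `‖M‖_∞`. -/
noncomputable def rowSumNorm {m n : Type*} [Fintype n] (M : Matrix m n ℝ) : ℝ :=
  ⨆ i, ∑ j, |M i j|

/-- The maximum absolute column sum norm `‖M‖₁`. -/
noncomputable def colSumNorm {m n : Type*} [Fintype m] (M : Matrix m n ℝ) : ℝ :=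
  ⨆ j, ∑ i, |M i j|

/-- The smoothed factor function `u ↦ ∑_{x,y} η^{|x|+|y|} · p(xuy)`. -/
noncomputable def smoothedFactor {α : Type*} (η : ℝ) (p : List α → ℝ) (u : List α) : ℝ :=
  ∑' z : List α × List α, η ^ (z.1.length + z.2.length) * p (z.1 ++ u ++ z.2)

/-- A factorization `s = xuy` is determined by `s`, `|x|` and `|y|`. -/
theorem factorization_injective {α : Type*} :
    Function.Injective fun t : List α × (List α × List α) =>
      (t.2.1 ++ t.1 ++ t.2.2, (t.2.1.length, t.2.2.length)) := by
  rintro ⟨u, x, y⟩ ⟨u', x', y'⟩ h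
  simp only [Prod.mk.injEq] at h
  obtain ⟨h, hx, hy⟩ := h
  obtain ⟨h₁, rfl⟩ := List.append_inj' h hy
  obtain ⟨rfl, rfl⟩ := List.append_inj h₁ hx
  rfl

section SmoothedFactor

variable {α : Type*} {p : List α → ℝ} {η : ℝ}

theorem hasSum_mul_geometric_pair (hp0 : ∀ w, 0 ≤ p w) (hp1 : HasSum p 1)
    (hη0 : 0 ≤ η) (hη1 : η < 1) :
    HasSum (fun t : List α × (ℕ × ℕ) => p t.1 * (η ^ t.2.1 * η ^ t.2.2)) ((1 - η)⁻¹ ^ 2) := by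
  have hg := hasSum_geometric_of_lt_one hη0 hη1
  have hg0 : ∀ n : ℕ, 0 ≤ η ^ n := fun n => pow_nonneg hη0 n
  have h2 := hg.mul hg (hg.summable.mul_of_nonneg hg.summable hg0 hg0)
  have h3 := hp1.mul h2 (hp1.summable.mul_of_nonneg h2.summable hp0
    fun t => mul_nonneg (hg0 _) (hg0 _))
  simpa [sq] using h3

theorem smoothed_term_eq :
    (fun t : List α × (List α × List α) =>
      η ^ (t.2.1.length + t.2.2.length) * p (t.2.1 ++ t.1 ++ t.2.2)) =
    (fun t : List α × (ℕ × ℕ) => p t.1 * (η ^ t.2.1 * η ^ t.2.2)) ∘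
      fun t : List α × (List α × List α) =>
        (t.2.1 ++ t.1 ++ t.2.2, (t.2.1.length, t.2.2.length)) := by
  funext t
  simp only [Function.comp_apply, pow_add]
  ring

theorem summable_smoothed_term (hp0 : ∀ w, 0 ≤ p w) (hp1 : HasSum p 1)
    (hη0 : 0 ≤ η) (hη1 : η < 1) :
    Summable fun t : List α × (List α × List α) =>
      η ^ (t.2.1.length + t.2.2.length) * p (t.2.1 ++ t.1 ++ t.2.2) := by
  rw [smoothed_term_eq]
  exact (hasSum_mul_geometric_pair hp0 hp1 hη0 hη1).summable.comp_injective
    factorization_injective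

theorem smoothedFactor_nonneg (hp0 : ∀ w, 0 ≤ p w) (hη0 : 0 ≤ η) (u : List α) :
    0 ≤ smoothedFactor η p u :=
  tsum_nonneg fun _ => mul_nonneg (pow_nonneg hη0 _) (hp0 _)

theorem summable_smoothedFactor (hp0 : ∀ w, 0 ≤ p w) (hp1 : HasSum p 1)
    (hη0 : 0 ≤ η) (hη1 : η < 1) : Summable (smoothedFactor η p) :=
  (summable_smoothed_term hp0 hp1 hη0 hη1).prod

theorem tsum_smoothedFactor_le (hp0 : ∀ w, 0 ≤ p w) (hp1 : HasSum p 1)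
    (hη0 : 0 ≤ η) (hη1 : η < 1) : ∑' u, smoothedFactor η p u ≤ (1 - η)⁻¹ ^ 2 := by
  have hg := hasSum_mul_geometric_pair hp0 hp1 hη0 hη1
  have hs := summable_smoothed_term hp0 hp1 hη0 hη1
  have h := hs.tsum_prod
  refine h.symm.trans_le ?_
  rw [← hg.tsum_eq]
  refine hs.tsum_le_tsum_of_inj _ factorization_injective
    (fun t _ => mul_nonneg (hp0 _) (mul_nonneg (pow_nonneg hη0 _) (pow_nonneg hη0 _)))
    (fun t => (congrFun smoothed_term_eq t).le) hg.summable

theorem sum_smoothedFactor_comp_le (hp0 : ∀ w, 0 ≤ p w) (hp1 : HasSum p 1)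
    (hη0 : 0 ≤ η) (hη1 : η < 1) {ι : Type*} [Fintype ι] {f : ι → List α}
    (hf : Function.Injective f) :
    ∑ i, smoothedFactor η p (f i) ≤ ∑' u, smoothedFactor η p u := by
  have h := summable_smoothedFactor hp0 hp1 hη0 hη1
  rw [← tsum_fintype (L := .unconditional _)]
  exact (h.comp_injective hf).tsum_le_tsum_of_inj f hf
    (fun u _ => smoothedFactor_nonneg hp0 hη0 u) (fun _ => le_rfl) h

theorem abs_tsum_smoothed_sub_le {q : List α → ℝ} (hp0 : ∀ w, 0 ≤ p w) (hp1 : HasSum p 1)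
    (hq0 : ∀ w, 0 ≤ q w) (hq1 : HasSum q 1) (hη0 : 0 ≤ η) (hη1 : η < 1) (u : List α) :
    |∑' z : List α × List α, η ^ (z.1.length + z.2.length) *
      (q (z.1 ++ u ++ z.2) - p (z.1 ++ u ++ z.2))| ≤
      smoothedFactor η q u + smoothedFactor η p u := by
  have hp := (summable_smoothed_term hp0 hp1 hη0 hη1).prod_factor u
  have hq := (summable_smoothed_term hq0 hq1 hη0 hη1).prod_factor u
  simp only [mul_sub]
  rw [hq.tsum_sub hp]
  refine (abs_sub _ _).trans_eq ?_
  exact congrArg₂ (· + ·) (abs_of_nonneg (smoothedFactor_nonneg hq0 hη0 u))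
    (abs_of_nonneg (smoothedFactor_nonneg hp0 hη0 u))

end SmoothedFactor

/-- Schur's test: common bounds on the absolute row and column sums bound the spectral norm. -/
theorem specNorm_le_of_sum_abs_le {m n : Type*} [Fintype m] [Fintype n] [DecidableEq n]
    {M : Matrix m n ℝ} {C : ℝ} (hC : 0 ≤ C) (hrow : ∀ i, ∑ j, |M i j| ≤ C)
    (hcol : ∀ j, ∑ i, |M i j| ≤ C) : specNorm M ≤ C := by
  refine ContinuousLinearMap.opNorm_le_bound _ hC fun x => ?_
  refine le_of_sq_le_sq ?_ (by positivity)
  rw [mul_pow, EuclideanSpace.norm_sq_eq, EuclideanSpace.norm_sq_eq]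
  simp only [Real.norm_eq_abs, sq_abs, LinearMap.coe_toContinuousLinearMap',
    Matrix.ofLp_toLpLin, Matrix.toLin'_apply]
  calc ∑ i, ((M *ᵥ x.ofLp) i) ^ 2
      ≤ ∑ i, C * ∑ j, |M i j| * x j ^ 2 := by
        refine Finset.sum_le_sum fun i _ => ?_
        refine (Finset.sum_sq_le_sum_mul_sum_of_sq_le_mul Finset.univ
          (f := fun j => |M i j|) (g := fun j => |M i j| * x j ^ 2)
          (fun j _ => abs_nonneg _) (fun j _ => by positivity) fun j _ => ?_).trans ?_
        · rw [← mul_assoc, ← sq, sq_abs, mul_pow]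
        · exact mul_le_mul_of_nonneg_right (hrow i) (Finset.sum_nonneg fun j _ => by positivity)
    _ = C * ∑ j, (∑ i, |M i j|) * x j ^ 2 := by
        rw [← Finset.mul_sum, Finset.sum_comm]
        simp only [Finset.sum_mul]
    _ ≤ C * ∑ j, C * x j ^ 2 := by
        gcongr with j
        exact hcol j
    _ = C ^ 2 * ∑ j, x j ^ 2 := by
        rw [← Finset.mul_sum, sq, mul_assoc]

/-- for a stochastic language `p`, `0 ≤ η < 1`, finite `U, V ⊆ Σ*` and
`w ∈ Σ*`, the `U × V` matrix `Ẑ_{η,w}[u,v] = ∑_{x,y} η^{|x|+|y|}·(1_{w=xuvy} − p(xuvy))`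
satisfies `‖Ẑ_{η,w}‖_∞ ≤ (1−η)⁻² + S_{p̂_η}⁽¹⁾`, `‖Ẑ_{η,w}‖₁ ≤ (1−η)⁻² + S_{p̂_η}⁽¹⁾`
and `‖Ẑ_{η,w}‖₂ ≤ (1−η)⁻² + S_{p̂_η}⁽¹⁾`, where
`S_{p̂_η}⁽¹⁾ = ∑_u ∑_{x,y} η^{|x|+|y|}·p(xuy)`. -/
theorem factor_hankel_summand_norm_bound {α : Type*} [Fintype α] [DecidableEq α]
    (p : List α → ℝ) (hp0 : ∀ w, 0 ≤ p w) (hp1 : HasSum p 1)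
    (η : ℝ) (hη0 : 0 ≤ η) (hη1 : η < 1)
    (U V : Finset (List α)) (w : List α)
    (Z : Matrix ↥U ↥V ℝ)
    (hZ : ∀ (u : ↥U) (v : ↥V), Z u v =
      ∑' z : List α × List α, η ^ (z.1.length + z.2.length) *
        ((if w = z.1 ++ ↑u ++ ↑v ++ z.2 then 1 else 0) - p (z.1 ++ ↑u ++ ↑v ++ z.2))) :
    rowSumNorm Z ≤ (1 - η)⁻¹ ^ 2 +
      (∑' u : List α, ∑' z : List α × List α,
        η ^ (z.1.length + z.2.length) * p (z.1 ++ u ++ z.2)) ∧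
    colSumNorm Z ≤ (1 - η)⁻¹ ^ 2 +
      (∑' u : List α, ∑' z : List α × List α,
        η ^ (z.1.length + z.2.length) * p (z.1 ++ u ++ z.2)) ∧
    specNorm Z ≤ (1 - η)⁻¹ ^ 2 +
      (∑' u : List α, ∑' z : List α × List α,
        η ^ (z.1.length + z.2.length) * p (z.1 ++ u ++ z.2)) := by
  have hq0 : ∀ s : List α, (0 : ℝ) ≤ if w = s then 1 else 0 := fun s => by positivity
  have hq1 : HasSum (fun s : List α => if w = s then (1 : ℝ) else 0) 1 := by
    simpa only [eq_comm] using hasSum_ite_eq w (1 : ℝ)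
  change rowSumNorm Z ≤ (1 - η)⁻¹ ^ 2 + ∑' u, smoothedFactor η p u ∧
    colSumNorm Z ≤ (1 - η)⁻¹ ^ 2 + ∑' u, smoothedFactor η p u ∧
    specNorm Z ≤ (1 - η)⁻¹ ^ 2 + ∑' u, smoothedFactor η p u
  have hC : 0 ≤ (1 - η)⁻¹ ^ 2 + ∑' u, smoothedFactor η p u :=
    add_nonneg (sq_nonneg _) (tsum_nonneg (smoothedFactor_nonneg hp0 hη0))
  have hentry (u : ↥U) (v : ↥V) : |Z u v| ≤
      smoothedFactor η (fun s => if w = s then 1 else 0) (↑u ++ ↑v) +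
        smoothedFactor η p (↑u ++ ↑v) := by
    rw [hZ]
    simpa only [List.append_assoc] using
      abs_tsum_smoothed_sub_le hp0 hp1 hq0 hq1 hη0 hη1 (u.1 ++ v.1)
  have hbound {ι : Type _} [Fintype ι] {f : ι → List α} (hf : Function.Injective f) :
      ∑ i, (smoothedFactor η (fun s => if w = s then 1 else 0) (f i) +
        smoothedFactor η p (f i)) ≤ (1 - η)⁻¹ ^ 2 + ∑' u, smoothedFactor η p u := by
    rw [Finset.sum_add_distrib]
    exact add_le_add ((sum_smoothedFactor_comp_le hq0 hq1 hη0 hη1 hf).trans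
      (tsum_smoothedFactor_le hq0 hq1 hη0 hη1)) (sum_smoothedFactor_comp_le hp0 hp1 hη0 hη1 hf)
  have hrow (u : ↥U) : ∑ v, |Z u v| ≤ (1 - η)⁻¹ ^ 2 + ∑' u, smoothedFactor η p u :=
    (Finset.sum_le_sum fun v _ => hentry u v).trans
      (hbound fun _ _ h => Subtype.ext (List.append_cancel_left h))
  have hcol (v : ↥V) : ∑ u, |Z u v| ≤ (1 - η)⁻¹ ^ 2 + ∑' u, smoothedFactor η p u :=
    (Finset.sum_le_sum fun u _ => hentry u v).trans
      (hbound fun _ _ h => Subtype.ext (List.append_cancel_right h))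
  exact ⟨Real.iSup_le hrow hC, Real.iSup_le hcol hC, specNorm_le_of_sum_abs_le hC hrow hcol⟩
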